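/- Let m, n > 1 and let R = (r_1, …, r_m), C = (c_1, …, c_n) be positive integer vectors with Σ_i r_i = Σ_j c_j = N. Let Y = (y_{ij}) be the independence matrix with y_{ij} = r_i c_j / N, and let g(X) = Σ_{i,j} [(x_{ij}+1) ln(x_{ij}+1) − x_{ij} ln x_{ij}]. Then ln ρ(R, C) ≥ g(Y), i.e., ρ(R, C) ≥ exp{ Σ_{i,j} [ (r_i c_j/N + 1) ln(r_i c_j/N + 1) − (r_i c_j/N) ln(r_i c_j/N) ] }. -/

import Mathlib

/-- The convex conjugate inequality for `t ↦ t log t - (t + 1) log (t + 1)`. -/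
theorem entropy_le_neg_mul_log_sub_log {t z : ℝ} (ht : 0 < t) (hz0 : 0 < z) (hz1 : z < 1) :
    (t + 1) * Real.log (t + 1) - t * Real.log t ≤ -(t * Real.log z) - Real.log (1 - z) := by
  have h1z : 0 < 1 - z := sub_pos.2 hz1
  have ht1 : 0 < t + 1 := by linarith
  have h1 := Real.log_le_sub_one_of_pos (show 0 < z * (t + 1) / t by positivity)
  have h2 := Real.log_le_sub_one_of_pos (show 0 < (1 - z) * (t + 1) by positivity)
  rw [Real.log_div (by positivity) ht.ne', Real.log_mul hz0.ne' ht1.ne'] at h1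
  rw [Real.log_mul h1z.ne' ht1.ne'] at h2
  have h3 := mul_le_mul_of_nonneg_left h1 ht.le
  have h4 : t * (z * (t + 1) / t - 1) = z * (t + 1) - t := by field_simp
  linarith


/-- For the independence matrix `Y` with `y_{ij} = r_i c_j / N` and
`g(X) = Σ (x_{ij}+1) ln(x_{ij}+1) − x_{ij} ln x_{ij}`, one has `ln ρ(R,C) ≥ g(Y)`,
i.e. `ρ(R,C) ≥ exp g(Y)`. -/
theorem rho_ge_exp_g_independence_matrix
    (m n N : ℕ) (hm : 1 < m) (hn : 1 < n)
    (r : Fin m → ℕ) (c : Fin n → ℕ)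
    (hr : ∀ i, 0 < r i) (hc : ∀ j, 0 < c j)
    (hrN : ∑ i, r i = N) (hcN : ∑ j, c j = N)
    (ρ : ℝ)
    (hρ : IsLeast {z : ℝ | ∃ (x : Fin m → ℝ) (y : Fin n → ℝ),
      (∀ i, x i ∈ Set.Ioo (0 : ℝ) 1) ∧ (∀ j, y j ∈ Set.Ioo (0 : ℝ) 1) ∧
      (∏ i, x i ^ (-(r i : ℤ))) * (∏ j, y j ^ (-(c j : ℤ))) *
        (∏ i, ∏ j, (1 - x i * y j)⁻¹) = z} ρ) :
    ρ ≥ Real.exp (∑ i, ∑ j,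
      (((r i : ℝ) * (c j : ℝ) / N + 1) * Real.log ((r i : ℝ) * (c j : ℝ) / N + 1) -
        ((r i : ℝ) * (c j : ℝ) / N) * Real.log ((r i : ℝ) * (c j : ℝ) / N))) := by
  obtain ⟨⟨x, y, hx, hy, rfl⟩, -⟩ := hρ
  have hx0 i : 0 < x i := (hx i).1
  have hy0 j : 0 < y j := (hy j).1
  have hxy0 i j : 0 < x i * y j := mul_pos (hx0 i) (hy0 j)
  have hxy1 i j : x i * y j < 1 := mul_lt_one_of_nonneg_of_lt_one_left (hx0 i).le (hx i).2 (hy j).2.le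
  have hsub i j : 0 < 1 - x i * y j := sub_pos.2 (hxy1 i j)
  have hN : (0 : ℝ) < N := by
    rw [← hrN]
    exact_mod_cast Finset.sum_pos (fun i _ => hr i) ⟨⟨0, by omega⟩, Finset.mem_univ _⟩
  have hr' : ∑ i, (r i : ℝ) = N := by exact_mod_cast hrN
  have hc' : ∑ j, (c j : ℝ) = N := by exact_mod_cast hcN
  have hX : 0 < ∏ i, x i ^ (-(r i : ℤ)) := Finset.prod_pos fun i _ => zpow_pos (hx0 i) _
  have hY : 0 < ∏ j, y j ^ (-(c j : ℤ)) := Finset.prod_pos fun j _ => zpow_pos (hy0 j) _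
  have hXY : 0 < ∏ i, ∏ j, (1 - x i * y j)⁻¹ :=
    Finset.prod_pos fun i _ => Finset.prod_pos fun j _ => inv_pos.2 (hsub i j)
  have hlogXY : Real.log (∏ i, ∏ j, (1 - x i * y j)⁻¹) =
      ∑ i, ∑ j, -Real.log (1 - x i * y j) := by
    rw [Real.log_prod fun i _ => (Finset.prod_pos fun j _ => inv_pos.2 (hsub i j)).ne']
    refine Finset.sum_congr rfl fun i _ => ?_
    rw [Real.log_prod fun j _ => (inv_pos.2 (hsub i j)).ne']
    simp only [Real.log_inv]
  have hsumx : ∑ i, ∑ j, (r i : ℝ) * c j / N * Real.log (x i) = ∑ i, r i * Real.log (x i) := by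
    refine Finset.sum_congr rfl fun i _ => ?_
    rw [← Finset.sum_mul, ← Finset.sum_div, ← Finset.mul_sum, hc', mul_div_cancel_right₀ _ hN.ne']
  have hsumy : ∑ i, ∑ j, (r i : ℝ) * c j / N * Real.log (y j) = ∑ j, c j * Real.log (y j) := by
    rw [Finset.sum_comm]
    refine Finset.sum_congr rfl fun j _ => ?_
    rw [← Finset.sum_mul, ← Finset.sum_div, ← Finset.sum_mul, hr', mul_div_cancel_left₀ _ hN.ne']
  rw [ge_iff_le, ← Real.le_log_iff_exp_le (by positivity), Real.log_mul (by positivity) hXY.ne',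
    Real.log_mul hX.ne' hY.ne', hlogXY, Real.log_prod fun i _ => (zpow_pos (hx0 i) _).ne',
    Real.log_prod fun j _ => (zpow_pos (hy0 j) _).ne']
  simp only [Real.log_zpow, Int.cast_neg, Int.cast_natCast, neg_mul, Finset.sum_neg_distrib]
  rw [← hsumx, ← hsumy]
  simp only [← Finset.sum_neg_distrib, ← Finset.sum_add_distrib]
  refine Finset.sum_le_sum fun i _ => Finset.sum_le_sum fun j _ => ?_
  have hri : (0 : ℝ) < r i := by exact_mod_cast hr i
  have hcj : (0 : ℝ) < c j := by exact_mod_cast hc j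
  have h := entropy_le_neg_mul_log_sub_log (t := (r i : ℝ) * c j / N) (by positivity)
    (hxy0 i j) (hxy1 i j)
  rw [Real.log_mul (hx0 i).ne' (hy0 j).ne'] at h
  linarith
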